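/- Let q be a prime power. As n → ∞, the proportion c_A(n,q) of cyclic elements of the affine group A(n,q) converges to [(1 − 1/q)/(1 − 1/q + 1/q^2)] · [(1 − 1/q^5)/(1 + 1/q^3)]. -/

import Mathlib

open Matrix

/-- Membership in the affine group `A(n,q)`: invertible `(n+1) × (n+1)` matrices with
`x_{11} = 1` and `x_{j1} = 0` for `j ≥ 2` (indices starting at `0` in Lean). -/
def IsAff {F : Type} [Field F] {n : ℕ} (x : GL (Fin (n + 1)) F) : Prop :=
  x.val 0 0 = 1 ∧ ∀ j : Fin (n + 1), j ≠ 0 → x.val j 0 = 0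

/-- `c_A(n,q)`: the proportion of cyclic elements (characteristic polynomial equal to the
minimal polynomial) of the affine group `A(n,q)`. -/
noncomputable def cA (F : Type) [Field F] [Fintype F] (n : ℕ) : ℝ :=
  (Nat.card {x : GL (Fin (n + 1)) F //
      IsAff x ∧ x.val.charpoly = minpoly F x.val} : ℝ) /
    (Nat.card {x : GL (Fin (n + 1)) F // IsAff x} : ℝ)

section PolynomialCounting

open Polynomial

/-- The finite set of monic polynomials of degree `n` over a finite field. -/
noncomputable def monicFinset (F : Type*) [Field F] [Finite F] (n : ℕ) : Finset F[X] :=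
  Set.Finite.toFinset (s := {f : F[X] | f.Monic ∧ f.natDegree = n}) <| by
    have : Finite (degreeLT F n) := Finite.of_equiv _ (degreeLTEquiv F n).symm.toEquiv
    exact Set.finite_coe_iff.1 (Finite.of_equiv _ (monicEquivDegreeLT (R := F) n).symm)

/-- Monic irreducible polynomials. -/
abbrev MonicIrred (F : Type*) [Field F] := {p : F[X] // p.Monic ∧ Irreducible p}

namespace MonicIrred

variable {F : Type*} [Field F]

/-- The norm `q ^ deg p` of a monic irreducible polynomial. -/
noncomputable def norm (p : MonicIrred F) : ℝ := (Nat.card F : ℝ) ^ p.1.natDegree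

lemma natDegree_pos (p : MonicIrred F) : 0 < p.1.natDegree := p.2.2.natDegree_pos

lemma isCoprime_of_ne {p p' : MonicIrred F} (h : p ≠ p') : IsCoprime p.1 p'.1 := by
  refine (p.2.2.coprime_iff_not_dvd).2 fun hd => h (Subtype.ext ?_)
  exact eq_of_monic_of_associated p.2.1 p'.2.1 (p.2.2.associated_of_dvd p'.2.2 hd)

end MonicIrred

section

variable {F : Type*} [Field F]

/-- The finite set of monic irreducible divisors of a nonzero polynomial. -/
noncomputable def irredDivisors (f : F[X]) : Finset (MonicIrred F) :=
  Set.Finite.toFinset (s := {p : MonicIrred F | f ≠ 0 ∧ p.1 ∣ f}) <| by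
    classical
    refine Set.Finite.subset
      ((UniqueFactorizationMonoid.normalizedFactors f).toFinset.finite_toSet.preimage
      (Subtype.val_injective.injOn)) fun p hp => ?_
    simp only [Set.mem_preimage, Finset.mem_coe, Multiset.mem_toFinset]
    rw [UniqueFactorizationMonoid.mem_normalizedFactors_iff' hp.1]
    exact ⟨p.2.2, p.2.1.normalize_eq_self, hp.2⟩

lemma mem_irredDivisors {f : F[X]} (hf : f ≠ 0) {p : MonicIrred F} :
    p ∈ irredDivisors f ↔ p.1 ∣ f := by
  simp [irredDivisors, hf]

lemma subset_irredDivisors {f : F[X]} (hf : f ≠ 0) {S : Finset (MonicIrred F)} :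
    S ⊆ irredDivisors f ↔ ∏ p ∈ S, p.1 ∣ f := by
  constructor
  · intro h
    exact Finset.prod_dvd_of_coprime (fun p _ p' _ hne => MonicIrred.isCoprime_of_ne hne)
      fun p hp => (mem_irredDivisors hf).1 (h hp)
  · intro h p hp
    exact (mem_irredDivisors hf).2 ((Finset.dvd_prod_of_mem _ hp).trans h)

lemma exists_monicIrred_dvd {f : F[X]} (hf : ¬ IsUnit f) : ∃ p : MonicIrred F, p.1 ∣ f := by
  classical
  obtain ⟨g, hg, hgf⟩ := Polynomial.exists_monic_irreducible_factor f hf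
  exact ⟨⟨g, hg, hgf.1⟩, hgf.2⟩

lemma isCoprime_iff_irredDivisors {f g : F[X]} (hf : f ≠ 0) (hg : g ≠ 0) :
    IsCoprime f g ↔ ∀ p ∈ irredDivisors f, p ∉ irredDivisors g := by
  constructor
  · intro h p hp hp'
    rw [mem_irredDivisors hf] at hp
    rw [mem_irredDivisors hg] at hp'
    exact p.2.2.not_isUnit (h.isUnit_of_dvd' hp hp')
  · intro h
    classical
    by_contra hc
    rw [← EuclideanDomain.gcd_isUnit_iff] at hc
    obtain ⟨p, hp⟩ := exists_monicIrred_dvd hc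
    exact h p ((mem_irredDivisors hf).2 (hp.trans (EuclideanDomain.gcd_dvd_left _ _)))
      ((mem_irredDivisors hg).2 (hp.trans (EuclideanDomain.gcd_dvd_right _ _)))

/-- Total degree of a finite set of monic irreducible polynomials. -/
noncomputable def totalDegree (S : Finset (MonicIrred F)) : ℕ := ∑ p ∈ S, p.1.natDegree

lemma monic_prod_val (S : Finset (MonicIrred F)) : (∏ p ∈ S, p.1).Monic :=
  monic_prod_of_monic _ _ fun p _ => p.2.1

lemma natDegree_prod_val (S : Finset (MonicIrred F)) :
    (∏ p ∈ S, p.1).natDegree = totalDegree S :=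
  natDegree_prod_of_monic _ _ fun p _ => p.2.1

lemma prod_norm (S : Finset (MonicIrred F)) :
    ∏ p ∈ S, p.norm = (Nat.card F : ℝ) ^ totalDegree S := by
  simp [MonicIrred.norm, totalDegree, Finset.prod_pow_eq_pow_sum]

end

variable {F : Type*} [Field F] [Finite F]

lemma mem_monicFinset {n : ℕ} {f : F[X]} :
    f ∈ monicFinset F n ↔ f.Monic ∧ f.natDegree = n := by
  simp [monicFinset]

lemma card_monicFinset (n : ℕ) : (monicFinset F n).card = Nat.card F ^ n := by
  rw [← Nat.subtype_card (p := fun f : F[X] => f.Monic ∧ f.natDegree = n) _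
    (fun _ => mem_monicFinset),
    Nat.card_congr ((monicEquivDegreeLT (R := F) n).trans (degreeLTEquiv F n).toEquiv),
    Nat.card_fun, Nat.card_fin]

lemma card_filter_dvd {n : ℕ} {d : F[X]} (hd : d.Monic) (hn : d.natDegree ≤ n)
    [DecidablePred (d ∣ ·)] :
    ((monicFinset F n).filter (d ∣ ·)).card = Nat.card F ^ (n - d.natDegree) := by
  rw [← card_monicFinset]
  symm
  refine Finset.card_bij (fun k _ => d * k) ?_ ?_ ?_
  · intro k hk
    rw [mem_monicFinset] at hk
    simp only [Finset.mem_filter, mem_monicFinset, dvd_mul_right, and_true]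
    refine ⟨hd.mul hk.1, ?_⟩
    rw [hd.natDegree_mul hk.1, hk.2]
    omega
  · intro a _ b _ h
    exact mul_left_cancel₀ hd.ne_zero h
  · intro f hf
    simp only [Finset.mem_filter, mem_monicFinset] at hf
    obtain ⟨⟨hm, hdeg⟩, k, rfl⟩ := hf
    have hk := hd.of_mul_monic_left hm
    refine ⟨k, mem_monicFinset.2 ⟨hk, ?_⟩, rfl⟩
    rw [hd.natDegree_mul hk] at hdeg
    omega

/-- The finite sets of monic irreducible polynomials of total degree at most `n`. -/
noncomputable def degLE (F : Type*) [Field F] [Finite F] (n : ℕ) :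
    Finset (Finset (MonicIrred F)) := by
  classical exact (monicFinset F n).biUnion fun f => (irredDivisors f).powerset

lemma mem_degLE {n : ℕ} {S : Finset (MonicIrred F)} : S ∈ degLE F n ↔ totalDegree S ≤ n := by
  simp only [degLE, Finset.mem_biUnion, mem_monicFinset, Finset.mem_powerset]
  constructor
  · rintro ⟨f, ⟨hf, rfl⟩, hS⟩
    rw [subset_irredDivisors hf.ne_zero] at hS
    rw [← natDegree_prod_val]
    exact natDegree_le_of_dvd hS hf.ne_zero
  · intro h
    have hm : ((∏ p ∈ S, p.1) * X ^ (n - totalDegree S)).Monic :=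
      (monic_prod_val S).mul (monic_X_pow _)
    refine ⟨(∏ p ∈ S, p.1) * X ^ (n - totalDegree S), ⟨hm, ?_⟩, ?_⟩
    · rw [(monic_prod_val S).natDegree_mul (monic_X_pow _), natDegree_prod_val, natDegree_X_pow]
      omega
    · rw [subset_irredDivisors hm.ne_zero]
      exact dvd_mul_right _ _

lemma sum_monic_prod_one_add (w : MonicIrred F → ℝ) (n : ℕ) :
    ∑ f ∈ monicFinset F n, ∏ p ∈ irredDivisors f, (1 + w p) =
      ∑ S ∈ degLE F n, (∏ p ∈ S, w p) * (Nat.card F : ℝ) ^ (n - totalDegree S) := by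
  classical
  simp_rw [Finset.prod_one_add]
  have key : ∀ f ∈ monicFinset F n, ∑ S ∈ (irredDivisors f).powerset, ∏ p ∈ S, w p =
      ∑ S ∈ degLE F n, if (∏ p ∈ S, p.1) ∣ f then ∏ p ∈ S, w p else 0 := by
    intro f hf
    rw [← Finset.sum_filter]
    refine Finset.sum_congr ?_ fun _ _ => rfl
    ext S
    have hf0 := (mem_monicFinset.1 hf).1.ne_zero
    simp only [Finset.mem_powerset, Finset.mem_filter, subset_irredDivisors hf0, iff_and_self]
    intro hS
    exact Finset.mem_biUnion.2 ⟨f, hf, Finset.mem_powerset.2 ((subset_irredDivisors hf0).2 hS)⟩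
  rw [Finset.sum_congr rfl key, Finset.sum_comm]
  refine Finset.sum_congr rfl fun S hS => ?_
  rw [mem_degLE] at hS
  rw [← Finset.sum_filter, Finset.sum_const, card_filter_dvd (monic_prod_val S)
    (by rwa [natDegree_prod_val]), natDegree_prod_val, nsmul_eq_mul, mul_comm]
  push_cast
  rfl

lemma one_lt_card : (1 : ℝ) < Nat.card F := by exact_mod_cast Finite.one_lt_card

lemma MonicIrred.one_lt_norm (p : MonicIrred F) : 1 < p.norm :=
  one_lt_pow₀ one_lt_card p.natDegree_pos.ne'

omit [Finite F] in
lemma isUnit_mk_iff {h f : F[X]} : IsUnit (AdjoinRoot.mk h f) ↔ IsCoprime f h := by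
  constructor
  · intro hu
    obtain ⟨b, hb⟩ := hu.exists_right_inv
    obtain ⟨g, rfl⟩ := AdjoinRoot.mk_surjective b
    rw [← map_mul, ← map_one (AdjoinRoot.mk h), AdjoinRoot.mk_eq_mk] at hb
    obtain ⟨k, hk⟩ := hb
    exact ⟨g, -k, by linear_combination hk⟩
  · rintro ⟨a, b, hab⟩
    refine IsUnit.of_mul_eq_one (AdjoinRoot.mk h a) ?_
    rw [← map_mul, ← map_one (AdjoinRoot.mk h), AdjoinRoot.mk_eq_mk]
    exact ⟨-b, by linear_combination hab⟩

lemma exists_mem_monicFinset_mk {h : F[X]} (hh : h.Monic) (x : AdjoinRoot h) :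
    ∃ f ∈ monicFinset F h.natDegree, AdjoinRoot.mk h f = x := by
  obtain ⟨g, rfl⟩ := AdjoinRoot.mk_surjective x
  have hdeg : (g %ₘ h).degree < h.degree := degree_modByMonic_lt g hh
  refine ⟨h + g %ₘ h, mem_monicFinset.2 ⟨hh.add_of_left hdeg, ?_⟩, ?_⟩
  · exact natDegree_add_eq_left_of_degree_lt hdeg
  · rw [AdjoinRoot.mk_eq_mk]
    refine ⟨1 - g /ₘ h, ?_⟩
    have := modByMonic_add_div g h
    linear_combination this

lemma card_units_adjoinRoot_eq_card_coprime {h : F[X]} (hh : h.Monic)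
    [DecidablePred fun f : F[X] => IsCoprime f h] :
    Nat.card (AdjoinRoot h)ˣ =
      ((monicFinset F h.natDegree).filter fun f => IsCoprime f h).card := by
  rw [← Nat.subtype_card (p := fun f => f ∈ monicFinset F h.natDegree ∧ IsCoprime f h) _
    (fun _ => Finset.mem_filter)]
  symm
  refine Nat.card_eq_of_bijective (fun f => (isUnit_mk_iff.2 f.2.2).unit) ⟨?_, ?_⟩
  · rintro ⟨f, hf, hfh⟩ ⟨g, hg, hgh⟩ hfg
    have := congrArg Units.val hfg
    simp only [IsUnit.unit_spec, AdjoinRoot.mk_eq_mk] at this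
    rw [mem_monicFinset] at hf hg
    have h0 : f - g = 0 := by
      refine eq_zero_of_dvd_of_degree_lt this ?_
      rw [degree_eq_natDegree hh.ne_zero, ← hf.2, ← degree_eq_natDegree hf.1.ne_zero]
      refine degree_sub_lt_left ?_ hf.1.ne_zero (by rw [hf.1.leadingCoeff, hg.1.leadingCoeff])
      rw [degree_eq_natDegree hf.1.ne_zero, degree_eq_natDegree hg.1.ne_zero, hf.2, hg.2]
    exact Subtype.ext (sub_eq_zero.1 h0)
  · intro u
    obtain ⟨f, hf, hfu⟩ := exists_mem_monicFinset_mk hh u.1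
    refine ⟨⟨f, hf, isUnit_mk_iff.1 (hfu ▸ u.isUnit)⟩, Units.ext ?_⟩
    simpa using hfu

lemma card_units_adjoinRoot {h : F[X]} (hh : h.Monic) :
    (Nat.card (AdjoinRoot h)ˣ : ℝ) =
      (Nat.card F : ℝ) ^ h.natDegree * ∏ p ∈ irredDivisors h, (1 - 1 / p.norm) := by
  classical
  have hq : (Nat.card F : ℝ) ≠ 0 := (zero_lt_one.trans one_lt_card).ne'
  let w : MonicIrred F → ℝ := fun p => if p ∈ irredDivisors h then -1 else 0
  have h1 : ∀ f ∈ monicFinset F h.natDegree,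
      ∏ p ∈ irredDivisors f, (1 + w p) = if IsCoprime f h then 1 else 0 := by
    intro f hf
    have hf0 := (mem_monicFinset.1 hf).1.ne_zero
    rw [isCoprime_iff_irredDivisors hf0 hh.ne_zero]
    split_ifs with hc
    · exact Finset.prod_eq_one fun p hp => by simp [w, hc p hp]
    · push Not at hc
      obtain ⟨p, hp, hp'⟩ := hc
      exact Finset.prod_eq_zero hp (by simp [w, hp'])
  have h2 := sum_monic_prod_one_add w h.natDegree
  rw [Finset.sum_congr rfl h1, Finset.sum_boole, ← card_units_adjoinRoot_eq_card_coprime hh] at h2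
  rw [h2]
  have h3 : ∀ p : MonicIrred F, 1 - 1 / p.norm = 1 + -1 / p.norm := fun p => by ring
  simp_rw [h3]
  rw [Finset.prod_one_add, Finset.mul_sum]
  have hsub : (irredDivisors h).powerset ⊆ degLE F h.natDegree := by
    intro S hS
    rw [Finset.mem_powerset, subset_irredDivisors hh.ne_zero] at hS
    rw [mem_degLE, ← natDegree_prod_val]
    exact natDegree_le_of_dvd hS hh.ne_zero
  rw [← Finset.sum_subset hsub]
  · refine Finset.sum_congr rfl fun S hS => ?_
    have hle := mem_degLE.1 (hsub hS)
    rw [Finset.mem_powerset] at hS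
    rw [Finset.prod_div_distrib, prod_norm, pow_sub₀ _ hq hle,
      Finset.prod_congr rfl fun p hp => show w p = -1 by simp [w, hS hp]]
    ring
  · intro S _ hS
    rw [Finset.mem_powerset, Finset.not_subset] at hS
    obtain ⟨p, hp, hp'⟩ := hS
    rw [Finset.prod_eq_zero hp (by simp [w, hp']), zero_mul]

lemma summable_norm_rpow {k : ℕ} (hk : 1 ≤ k) :
    Summable fun p : MonicIrred F => 1 / p.norm ^ (k + 1) := by
  have hq : (1 : ℝ) < Nat.card F := one_lt_card
  have hq0 : (0 : ℝ) < Nat.card F := zero_lt_one.trans hq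
  have h1 : Summable fun x : (n : ℕ) × monicFinset F n =>
      1 / ((Nat.card F : ℝ) ^ x.1) ^ (k + 1) := by
    rw [summable_sigma_of_nonneg fun x => by positivity]
    refine ⟨fun n => Summable.of_finite, ?_⟩
    have : Summable fun n : ℕ => (((Nat.card F : ℝ) ^ k)⁻¹) ^ n :=
      summable_geometric_of_lt_one (by positivity)
        (inv_lt_one_of_one_lt₀ (one_lt_pow₀ hq (by omega)))
    refine this.congr fun n => ?_
    simp only [tsum_const, nsmul_eq_mul, Nat.card_eq_fintype_card, Fintype.card_coe,
      card_monicFinset]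
    push_cast
    rw [inv_pow, ← pow_mul, mul_one_div, eq_div_iff (by positivity)]
    rw [inv_mul_eq_iff_eq_mul₀ (by positivity), ← pow_mul, ← pow_add]
    congr 1
    ring
  let i : MonicIrred F → (n : ℕ) × monicFinset F n :=
    fun p => ⟨p.1.natDegree, p.1, mem_monicFinset.2 ⟨p.2.1, rfl⟩⟩
  have hi : Function.Injective i := by
    intro p p' h
    have : (i p).2.1 = (i p').2.1 := by rw [h]
    exact Subtype.ext this
  exact (h1.comp_injective hi).congr fun p => by simp only [i, Function.comp_apply, MonicIrred.norm]

lemma tendsto_sum_degLE {w : MonicIrred F → ℝ} (hw : Summable fun p => ‖w p‖) :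
    Filter.Tendsto (fun n => ∑ S ∈ degLE F n, ∏ p ∈ S, w p) Filter.atTop
      (nhds (∏' p, (1 + w p))) := by
  have hs := summable_finsetProd_of_summable_norm hw
  rw [tprod_one_add hs]
  refine hs.hasSum.comp (Filter.tendsto_atTop_finset_of_monotone ?_ ?_)
  · intro m n hmn S hS
    exact mem_degLE.2 ((mem_degLE.1 hS).trans hmn)
  · exact fun S => ⟨totalDegree S, mem_degLE.2 le_rfl⟩

lemma tendsto_average_prod {w : MonicIrred F → ℝ} (hw : Summable fun p => ‖w p / p.norm‖) :
    Filter.Tendsto (fun n => (∑ f ∈ monicFinset F n, ∏ p ∈ irredDivisors f, (1 + w p)) /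
      (Nat.card F : ℝ) ^ n) Filter.atTop (nhds (∏' p, (1 + w p / p.norm))) := by
  refine (tendsto_sum_degLE hw).congr fun n => ?_
  have hq : (Nat.card F : ℝ) ≠ 0 := (zero_lt_one.trans one_lt_card).ne'
  rw [sum_monic_prod_one_add, Finset.sum_div]
  refine Finset.sum_congr rfl fun S hS => ?_
  rw [Finset.prod_div_distrib, prod_norm, pow_sub₀ _ hq (mem_degLE.1 hS)]
  field_simp

/-- The sum of the Möbius function over the monic polynomials of degree `d`. -/
noncomputable def moebiusSum (F : Type*) [Field F] [Finite F] (d : ℕ) : ℝ :=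
  ∑ S ∈ degLE F d with totalDegree S = d, (-1) ^ S.card

lemma sum_degLE_eq (g : ℕ → ℝ) (n : ℕ) :
    ∑ S ∈ degLE F n, (-1) ^ S.card * g (totalDegree S) =
      ∑ d ∈ Finset.range (n + 1), moebiusSum F d * g d := by
  rw [← Finset.sum_fiberwise_of_maps_to (g := totalDegree) (t := Finset.range (n + 1))
    (fun S hS => Finset.mem_range.2 (Nat.lt_succ_of_le (mem_degLE.1 hS)))]
  refine Finset.sum_congr rfl fun d hd => ?_
  rw [moebiusSum, Finset.sum_mul]
  refine Finset.sum_congr ?_ fun S hS => ?_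
  · ext S
    simp only [Finset.mem_filter, mem_degLE]
    have := Finset.mem_range.1 hd
    constructor <;> rintro ⟨_, rfl⟩ <;> exact ⟨by omega, rfl⟩
  · rw [(Finset.mem_filter.1 hS).2]

lemma sum_moebiusSum (n : ℕ) :
    ∑ d ∈ Finset.range (n + 1), moebiusSum F d * (Nat.card F : ℝ) ^ (n - d) =
      if n = 0 then 1 else 0 := by
  rw [← sum_degLE_eq (fun d => (Nat.card F : ℝ) ^ (n - d))]
  have h1 := sum_monic_prod_one_add (F := F) (fun _ => -1) n
  simp only [Finset.prod_const] at h1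
  rw [← h1]
  split_ifs with hn
  · subst hn
    have : monicFinset F 0 = {1} := by
      ext f
      rw [mem_monicFinset, Finset.mem_singleton]
      exact ⟨fun h => h.1.natDegree_eq_zero.1 h.2, by rintro rfl; simp⟩
    rw [this, Finset.sum_singleton]
    have : irredDivisors (1 : F[X]) = ∅ := by
      ext p
      rw [mem_irredDivisors one_ne_zero]
      simpa using fun h => p.2.2.not_isUnit (isUnit_of_dvd_one h)
    simp [this]
  · refine Finset.sum_eq_zero fun f hf => ?_
    rw [mem_monicFinset] at hf
    obtain ⟨p, hp⟩ := exists_monicIrred_dvd (f := f) (fun hu => hn (by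
      rw [← hf.2]; exact natDegree_eq_zero_of_isUnit hu))
    rw [add_neg_cancel, zero_pow]
    exact Finset.card_ne_zero_of_mem ((mem_irredDivisors hf.1.ne_zero).2 hp)

lemma sum_moebiusSum_mul_pow (y : ℝ) (n : ℕ) :
    ∑ d ∈ Finset.range (n + 2), moebiusSum F d * y ^ d = 1 - Nat.card F * y := by
  have h0 : moebiusSum F 0 = 1 := by simpa using sum_moebiusSum (F := F) 0
  have hrec : ∀ n, moebiusSum F (n + 1) = - (Nat.card F : ℝ) * if n = 0 then 1 else 0 := by
    intro n
    have h1 := sum_moebiusSum (F := F) (n + 1)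
    rw [← sum_moebiusSum (F := F) n, Finset.mul_sum]
    rw [if_neg n.succ_ne_zero, Finset.sum_range_succ] at h1
    simp only [Nat.sub_self, pow_zero, mul_one] at h1
    rw [eq_neg_of_add_eq_zero_right h1, ← Finset.sum_neg_distrib]
    refine Finset.sum_congr rfl fun d hd => ?_
    have := Finset.mem_range.1 hd
    rw [show n + 1 - d = (n - d) + 1 by omega]
    ring
  induction n with
  | zero => simp [Finset.sum_range_succ, h0, hrec]; ring
  | succ n ih => rw [Finset.sum_range_succ, ih, hrec]; simp

lemma tprod_one_sub_norm {k : ℕ} (hk : 1 ≤ k) :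
    ∏' p : MonicIrred F, (1 + -(1 / p.norm ^ (k + 1))) = 1 - 1 / (Nat.card F : ℝ) ^ k := by
  have hq : (Nat.card F : ℝ) ≠ 0 := (zero_lt_one.trans one_lt_card).ne'
  have h1 := tendsto_sum_degLE (F := F) (w := fun p => -(1 / p.norm ^ (k + 1)))
    (by simpa only [norm_neg] using (summable_norm_rpow hk).norm)
  refine tendsto_nhds_unique h1 (tendsto_const_nhds.congr' ?_)
  filter_upwards [Filter.eventually_ge_atTop 1] with n hn
  obtain ⟨m, rfl⟩ := Nat.exists_eq_add_of_le' hn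
  have h2 := sum_moebiusSum_mul_pow (F := F) (1 / (Nat.card F : ℝ) ^ (k + 1)) m
  rw [← sum_degLE_eq] at h2
  rw [show (1 : ℝ) - 1 / (Nat.card F : ℝ) ^ k = 1 - Nat.card F * (1 / (Nat.card F : ℝ) ^ (k + 1)) by
    rw [pow_succ]; field_simp, ← h2]
  refine Finset.sum_congr rfl fun S _ => ?_
  rw [Finset.prod_neg, Finset.prod_div_distrib, Finset.prod_pow, prod_norm]
  simp only [Finset.prod_const_one, div_pow, one_pow, ← pow_mul]
  rw [mul_comm (totalDegree S)]

/-- The monic irreducible polynomial `X - a`. -/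
noncomputable def MonicIrred.linear {F : Type*} [Field F] (a : F) : MonicIrred F :=
  ⟨X - C a, monic_X_sub_C a, irreducible_X_sub_C a⟩

omit [Finite F] in
lemma MonicIrred.norm_linear (a : F) : (MonicIrred.linear a).norm = Nat.card F := by
  simp [MonicIrred.norm, MonicIrred.linear]

omit [Finite F] in
lemma linear_mem_irredDivisors {f : F[X]} (hf : f ≠ 0) {a : F} :
    MonicIrred.linear a ∈ irredDivisors f ↔ f.eval a = 0 := by
  rw [mem_irredDivisors hf, MonicIrred.linear, dvd_iff_isRoot, IsRoot]

omit [Finite F] in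
lemma summable_update [DecidableEq (MonicIrred F)] {w : MonicIrred F → ℝ}
    (hw : Summable fun p => ‖w p / p.norm‖) (a : MonicIrred F) (c : ℝ) :
    Summable fun p => ‖Function.update w a c p / p.norm‖ := by
  refine hw.congr_cofinite ?_
  filter_upwards [(Set.finite_singleton a).compl_mem_cofinite] with p hp
  rw [Function.update_of_ne hp]

omit [Finite F] in
lemma tprod_update [DecidableEq (MonicIrred F)] {w : MonicIrred F → ℝ}
    (hw : Summable fun p => ‖w p / p.norm‖) (a : MonicIrred F) (c : ℝ) :
    (∏' p, (1 + Function.update w a c p / p.norm)) * (1 + w a / a.norm) =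
      (∏' p, (1 + w p / p.norm)) * (1 + c / a.norm) := by
  have hm {v : MonicIrred F → ℝ} (hv : Summable fun p => ‖v p / p.norm‖) :
      Multipliable fun p => 1 + v p / p.norm :=
    multipliable_one_add_of_summable_prod (summable_finsetProd_of_summable_norm hv)
  have h1 (x : ℝ) : HasProd (fun p => if p = a then x else 1) x := hasProd_ite_eq a x
  refine ((hm (summable_update hw a c)).hasProd.mul (h1 _)).unique ?_
  convert (hm hw).hasProd.mul (h1 (1 + c / a.norm)) using 2 with p
  by_cases hp : p = a
  · subst hp
    simp [mul_comm]
  · simp [hp]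

lemma summable_one_div_norm_sub_one :
    Summable fun p : MonicIrred F => ‖1 / (p.norm - 1) / p.norm‖ := by
  refine Summable.of_nonneg_of_le (fun _ => norm_nonneg _) (fun p => ?_)
    ((summable_norm_rpow (F := F) le_rfl).mul_left 2)
  have h2 : 2 ≤ p.norm := by
    have h : 2 ≤ Nat.card F := Finite.one_lt_card
    calc (2 : ℝ) ≤ Nat.card F := by exact_mod_cast h
      _ ≤ p.norm := le_self_pow₀ (one_lt_card.le) p.natDegree_pos.ne'
  have h3 : 0 < p.norm - 1 := by linarith
  rw [Real.norm_of_nonneg (by positivity), div_div, mul_one_div,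
    div_le_div_iff₀ (by positivity) (by positivity)]
  rw [show 1 + 1 = 2 from rfl]
  nlinarith

lemma tprod_one_add_one_div_norm :
    (∏' p : MonicIrred F, (1 + 1 / (p.norm - 1) / p.norm)) *
      ((1 - 1 / (Nat.card F : ℝ) ^ 1) * (1 - 1 / (Nat.card F : ℝ) ^ 2)) =
        1 - 1 / (Nat.card F : ℝ) ^ 5 := by
  have hm {v : MonicIrred F → ℝ} (hv : Summable fun p => ‖v p‖) :
      Multipliable fun p => 1 + v p :=
    multipliable_one_add_of_summable_prod (summable_finsetProd_of_summable_norm hv)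
  have hk {k : ℕ} (hk : 1 ≤ k) : Multipliable fun p : MonicIrred F => 1 + -(1 / p.norm ^ (k + 1)) :=
    hm (by simpa only [norm_neg] using (summable_norm_rpow hk).norm)
  rw [← tprod_one_sub_norm (F := F) le_rfl, ← tprod_one_sub_norm (F := F) one_le_two,
    ← tprod_one_sub_norm (F := F) (k := 5) (by norm_num),
    ← (hk le_rfl).tprod_mul (hk one_le_two),
    ← (hm summable_one_div_norm_sub_one).tprod_mul ((hk le_rfl).mul (hk one_le_two))]
  refine tprod_congr fun p => ?_
  have h1 := p.one_lt_norm
  have h2 : p.norm ≠ 0 := by linarith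
  have h3 : p.norm - 1 ≠ 0 := by linarith
  field_simp
  ring

lemma one_div_card_units_adjoinRoot {n : ℕ} {f : F[X]} (hf : f ∈ monicFinset F n) :
    1 / (Nat.card (AdjoinRoot f)ˣ : ℝ) =
      (∏ p ∈ irredDivisors f, (1 + 1 / (p.norm - 1))) / (Nat.card F : ℝ) ^ n := by
  obtain ⟨hm, rfl⟩ := mem_monicFinset.1 hf
  rw [card_units_adjoinRoot hm, div_mul_eq_div_div_swap, one_div, ← Finset.prod_inv_distrib]
  congr 1
  refine Finset.prod_congr rfl fun p _ => ?_
  have h1 := p.one_lt_norm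
  have h2 : p.norm ≠ 0 := by linarith
  have h3 : p.norm - 1 ≠ 0 := by linarith
  field_simp
  ring

omit [Finite F] in
lemma prod_one_add_update [DecidableEq (MonicIrred F)] (w : MonicIrred F → ℝ) {f : F[X]}
    (hf : f ≠ 0) (a : F) [Decidable (f.eval a = 0)] :
    ∏ p ∈ irredDivisors f, (1 + Function.update w (.linear a) (-1) p) =
      if f.eval a = 0 then 0 else ∏ p ∈ irredDivisors f, (1 + w p) := by
  split_ifs with h
  · exact Finset.prod_eq_zero ((linear_mem_irredDivisors hf).2 h) (by simp)
  · refine Finset.prod_congr rfl fun p hp => ?_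
    rw [Function.update_of_ne]
    rintro rfl
    exact h ((linear_mem_irredDivisors hf).1 hp)

lemma affine_cyclic_constant {q T T1 T2 : ℝ} (hq1 : 1 < q)
    (e0 : T * ((1 - 1 / q ^ 1) * (1 - 1 / q ^ 2)) = 1 - 1 / q ^ 5)
    (e1 : T1 * (1 + 1 / (q - 1) / q) = T * (1 + -1 / q))
    (e2 : T2 * (1 + 1 / (q - 1) / q) = T1 * (1 + -1 / q)) :
    ((1 - 1 / q) / (1 - 1 / q + 1 / q ^ 2)) * ((1 - 1 / q ^ 5) / (1 + 1 / q ^ 3)) =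
      (q - 1) * (T1 - T2) := by
  have hq0 : q ≠ 0 := by linarith
  have hqm : q - 1 ≠ 0 := by linarith
  have hqp : q + 1 ≠ 0 := by linarith
  have hqq : q ^ 2 - q + 1 ≠ 0 := by nlinarith
  have hL : 1 + 1 / (q - 1) / q = (q ^ 2 - q + 1) / (q * (q - 1)) := by
    field_simp
  have hD : 1 + -1 / q = (q - 1) / q := by
    field_simp
    ring
  have hB : 1 - 1 / q + 1 / q ^ 2 = (q ^ 2 - q + 1) / q ^ 2 := by
    field_simp
  have hC : 1 + 1 / q ^ 3 = (q + 1) * (q ^ 2 - q + 1) / q ^ 3 := by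
    field_simp
    ring
  have hE : (1 - 1 / q ^ 1) * (1 - 1 / q ^ 2) = (q - 1) ^ 2 * (q + 1) / q ^ 3 := by
    field_simp
    ring
  rw [hL, hD, ← eq_div_iff (div_ne_zero hqq (mul_ne_zero hq0 hqm))] at e1 e2
  rw [hB, hC, ← e0, hE, e2, e1]
  generalize hQ : q ^ 2 - q + 1 = Q at *
  field_simp
  rw [← hQ]
  ring

open scoped Classical in
lemma tendsto_sum_one_div_card_units :
    Filter.Tendsto (fun n => ((Nat.card F : ℝ) - 1) *
      ∑ f ∈ monicFinset F n with f.eval 0 ≠ 0 ∧ f.eval 1 = 0, 1 / (Nat.card (AdjoinRoot f)ˣ : ℝ))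
      Filter.atTop (nhds (((1 - 1 / (Nat.card F : ℝ)) /
        (1 - 1 / (Nat.card F : ℝ) + 1 / (Nat.card F : ℝ) ^ 2)) *
        ((1 - 1 / (Nat.card F : ℝ) ^ 5) / (1 + 1 / (Nat.card F : ℝ) ^ 3)))) := by
  set w0 : MonicIrred F → ℝ := fun p => 1 / (p.norm - 1) with hw0
  set w1 := Function.update w0 (.linear 0) (-1) with hw1
  set w2 := Function.update w1 (.linear 1) (-1) with hw2
  have s0 : Summable fun p => ‖w0 p / p.norm‖ := summable_one_div_norm_sub_one
  have s1 : Summable fun p => ‖w1 p / p.norm‖ := summable_update s0 _ _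
  have s2 : Summable fun p => ‖w2 p / p.norm‖ := summable_update s1 _ _
  have hsum : ∀ n, ∑ f ∈ monicFinset F n with f.eval 0 ≠ 0 ∧ f.eval 1 = 0,
      1 / (Nat.card (AdjoinRoot f)ˣ : ℝ) =
      (∑ f ∈ monicFinset F n, ∏ p ∈ irredDivisors f, (1 + w1 p)) / (Nat.card F : ℝ) ^ n -
      (∑ f ∈ monicFinset F n, ∏ p ∈ irredDivisors f, (1 + w2 p)) / (Nat.card F : ℝ) ^ n := by
    intro n
    rw [← sub_div, ← Finset.sum_sub_distrib, Finset.sum_div, Finset.sum_filter]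
    refine Finset.sum_congr rfl fun f hf => ?_
    have hf0 := (mem_monicFinset.1 hf).1.ne_zero
    rw [one_div_card_units_adjoinRoot hf, prod_one_add_update w1 hf0 1,
      prod_one_add_update w0 hf0 0]
    by_cases h0 : f.eval 0 = 0 <;> by_cases h1 : f.eval 1 = 0 <;> simp [h0, h1, hw0]
  have hlim := ((tendsto_average_prod s1).sub (tendsto_average_prod s2)).const_mul
    ((Nat.card F : ℝ) - 1)
  simp_rw [hsum]
  convert hlim using 2
  have e1 := tprod_update s0 (.linear 0) (-1)
  have e2 := tprod_update s1 (.linear 1) (-1)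
  have e0 := tprod_one_add_one_div_norm (F := F)
  rw [← hw1] at e1
  rw [← hw2] at e2
  have hne : MonicIrred.linear (1 : F) ≠ MonicIrred.linear 0 := by
    intro h
    have := congrArg (fun p => p.1.eval 0) h
    simp [MonicIrred.linear] at this
  have hw11 : w1 (.linear 1) = 1 / ((Nat.card F : ℝ) - 1) := by
    rw [hw1, Function.update_of_ne hne, hw0]
    simp only [MonicIrred.norm_linear]
  have hw00 : w0 (.linear 0) = 1 / ((Nat.card F : ℝ) - 1) := by
    simp only [hw0, MonicIrred.norm_linear]
  rw [hw00, MonicIrred.norm_linear] at e1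
  rw [hw11, MonicIrred.norm_linear] at e2
  change (∏' p : MonicIrred F, (1 + w0 p / p.norm)) * _ = _ at e0
  exact affine_cyclic_constant one_lt_card e0 e1 e2
end PolynomialCounting

section CyclicMatrix

open Polynomial

variable {F ι : Type*} [Field F] [Fintype ι] [DecidableEq ι]

/-- Invertible matrices act as linear automorphisms of the coordinate space. -/
noncomputable def glLinearEquiv (F ι : Type*) [Field F] [Fintype ι] [DecidableEq ι] :
    GL ι F ≃* ((ι → F) ≃ₗ[F] (ι → F)) :=
  Matrix.GeneralLinearGroup.toLin.trans (LinearMap.GeneralLinearGroup.generalLinearEquiv F (ι → F))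

lemma glLinearEquiv_apply (g : GL ι F) (v : ι → F) : glLinearEquiv F ι g v = g.val *ᵥ v := rfl

lemma exists_linearEquiv_root_mul {x : Matrix ι ι F} (hx : x.charpoly = minpoly F x) :
    ∃ e : AdjoinRoot x.charpoly ≃ₗ[F] (ι → F), ∀ v, e (AdjoinRoot.root _ * v) = x *ᵥ e v := by
  obtain ⟨w, hw⟩ := Module.exists_ker_toSpanSingleton_eq_annihilator F[X]
    (Module.AEval' (Matrix.toLin' x))
  obtain ⟨w, rfl⟩ := (Module.AEval'.of _).surjective w
  rw [← span_minpoly_eq_annihilator, Matrix.minpoly_toLin', ← hx] at hw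
  have hf := (AdjoinRoot.powerBasis' x.charpoly_monic).finite
  let ψ : AdjoinRoot x.charpoly →ₗ[F] (ι → F) :=
    { toFun := fun v => aeval x (AdjoinRoot.modByMonicHom x.charpoly_monic v) *ᵥ w
      map_add' := fun a b => by rw [map_add, map_add, Matrix.add_mulVec]
      map_smul' := fun c a => by rw [map_smul, map_smul, Matrix.smul_mulVec, RingHom.id_apply] }
  have hψ_mk (p : F[X]) : ψ (AdjoinRoot.mk x.charpoly p) = aeval x p *ᵥ w := by
    change aeval x (AdjoinRoot.modByMonicHom x.charpoly_monic _) *ᵥ w = _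
    rw [AdjoinRoot.modByMonicHom_mk, aeval_modByMonic_eq_self_of_root
      (Matrix.aeval_self_charpoly x)]
  have hψ : Function.Injective ψ := by
    rw [injective_iff_map_eq_zero]
    intro v hv
    obtain ⟨p, rfl⟩ := AdjoinRoot.mk_surjective v
    refine AdjoinRoot.mk_eq_zero.2 (Ideal.mem_span_singleton.1 ?_)
    rw [← hw, LinearMap.mem_ker, LinearMap.toSpanSingleton_apply, ← Module.AEval.of_aeval_smul,
      LinearEquiv.map_eq_zero_iff, ← hv, hψ_mk]
    change aeval (Matrix.toLinAlgEquiv' x) p w = _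
    rw [aeval_algHom_apply]
    rfl
  have hd : Module.finrank F (AdjoinRoot x.charpoly) = Module.finrank F (ι → F) := by
    rw [(AdjoinRoot.powerBasis' x.charpoly_monic).finrank, AdjoinRoot.powerBasis'_dim,
      Matrix.charpoly_natDegree_eq_dim, Module.finrank_fintype_fun_eq_card]
  refine ⟨LinearMap.linearEquivOfInjective ψ hψ hd, fun v => ?_⟩
  obtain ⟨p, rfl⟩ := AdjoinRoot.mk_surjective v
  rw [← AdjoinRoot.mk_X, ← map_mul, LinearMap.linearEquivOfInjective_apply,
    LinearMap.linearEquivOfInjective_apply, hψ_mk, hψ_mk, map_mul, aeval_X, Matrix.mulVec_mulVec]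

lemma apply_mk_mul {h : F[X]} {x : Matrix ι ι F} {e : AdjoinRoot h ≃ₗ[F] (ι → F)}
    (he : ∀ v, e (AdjoinRoot.root h * v) = x *ᵥ e v) (p : F[X]) (v : AdjoinRoot h) :
    e (AdjoinRoot.mk h p * v) = aeval x p *ᵥ e v := by
  induction p using Polynomial.induction_on' generalizing v with
  | add p q hp hq => rw [map_add, add_mul, map_add, hp, hq, map_add, Matrix.add_mulVec]
  | monomial n a =>
    induction n generalizing v with
    | zero =>
      rw [monomial_zero_left, aeval_C, AdjoinRoot.mk_C, ← AdjoinRoot.algebraMap_eq,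
        ← Algebra.smul_def, map_smul, Algebra.algebraMap_eq_smul_one, Matrix.smul_mulVec,
        Matrix.one_mulVec]
    | succ n ih =>
      rw [← monomial_mul_X, map_mul (AdjoinRoot.mk h), AdjoinRoot.mk_X, mul_assoc, ih, he, map_mul,
        aeval_X, Matrix.mulVec_mulVec]

lemma exists_unit_of_root_mul {h : F[X]} {x : Matrix ι ι F} {e e' : AdjoinRoot h ≃ₗ[F] (ι → F)}
    (he : ∀ v, e (AdjoinRoot.root h * v) = x *ᵥ e v)
    (he' : ∀ v, e' (AdjoinRoot.root h * v) = x *ᵥ e' v) :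
    ∃ u : (AdjoinRoot h)ˣ, ∀ v, e v = e' (u * v) := by
  have key {e e' : AdjoinRoot h ≃ₗ[F] (ι → F)} (he : ∀ v, e (AdjoinRoot.root h * v) = x *ᵥ e v)
      (he' : ∀ v, e' (AdjoinRoot.root h * v) = x *ᵥ e' v) (v : AdjoinRoot h) :
      e v = e' (v * e'.symm (e 1)) := by
    obtain ⟨p, rfl⟩ := AdjoinRoot.mk_surjective v
    rw [apply_mk_mul he', e'.apply_symm_apply, ← apply_mk_mul he, mul_one]
  have hu (v : AdjoinRoot h) : v * (e'.symm (e 1) * e.symm (e' 1)) = v := by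
    rw [← mul_assoc]
    apply e.injective
    rw [key he he' v, ← key he' he]
  refine ⟨⟨e'.symm (e 1), e.symm (e' 1), ?_, ?_⟩, fun v => ?_⟩
  · rw [← one_mul (_ * _), hu]
  · rw [mul_comm, ← one_mul (_ * _), hu]
  · rw [key he he', mul_comm]

lemma charpoly_eq_minpoly_of_root_mul {h : F[X]} (hh : h.Monic)
    (hd : h.natDegree = Fintype.card ι) {x : Matrix ι ι F} {e : AdjoinRoot h ≃ₗ[F] (ι → F)}
    (he : ∀ v, e (AdjoinRoot.root h * v) = x *ᵥ e v) :
    x.charpoly = h ∧ minpoly F x = h := by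
  have h1 : minpoly F x ∣ h := by
    refine minpoly.dvd _ _ (Matrix.toLin'.injective (LinearMap.ext fun w => ?_))
    obtain ⟨v, rfl⟩ := e.surjective w
    rw [Matrix.toLin'_apply, ← apply_mk_mul he, AdjoinRoot.mk_self, zero_mul, map_zero, map_zero,
      LinearMap.zero_apply]
  have h2 : h ∣ minpoly F x := by
    rw [← AdjoinRoot.mk_eq_zero, ← mul_one (AdjoinRoot.mk h _), ← e.map_eq_zero_iff,
      apply_mk_mul he,
      minpoly.aeval, Matrix.zero_mulVec]
  have h3 : minpoly F x = h := eq_of_monic_of_associated (minpoly.monic (Matrix.isIntegral x)) hh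
    (associated_of_dvd_dvd h1 h2)
  refine ⟨?_, h3⟩
  refine (eq_of_monic_of_dvd_of_natDegree_le hh x.charpoly_monic ?_ ?_)
  · rw [← h3]; exact Matrix.minpoly_dvd_charpoly x
  · rw [Matrix.charpoly_natDegree_eq_dim, hd]

lemma exists_linearEquiv_apply_eq {V : Type*} [AddCommGroup V] [Module F V] {v w : V} (hv : v ≠ 0)
    (hw : w ≠ 0) : ∃ e : V ≃ₗ[F] V, e v = w := by
  obtain ⟨g, hg⟩ := Submodule.exists_linearEquiv_restrict_eq
    ((LinearEquiv.toSpanNonzeroSingleton F V v hv).symm.trans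
      (LinearEquiv.toSpanNonzeroSingleton F V w hw))
  refine ⟨g, ?_⟩
  have := hg (LinearEquiv.toSpanNonzeroSingleton F V v hv 1)
  rw [LinearEquiv.trans_apply, LinearEquiv.symm_apply_apply] at this
  simpa [-LinearEquiv.toSpanNonzeroSingleton_apply, LinearEquiv.toSpanNonzeroSingleton_one]
    using this.symm

/-- Cyclic invertible matrices fixing `w₀` with characteristic polynomial `h`. -/
abbrev CyclicFixing (w₀ : ι → F) (h : F[X]) :=
  {x : GL ι F // x.val *ᵥ w₀ = w₀ ∧ x.val.charpoly = minpoly F x.val ∧ x.val.charpoly = h}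

/-- Linear isomorphisms `F[X]/(h) ≃ F^ι` for which the preimage of `w₀` is fixed by the root. -/
abbrev FixingEquiv (w₀ : ι → F) (h : F[X]) :=
  {e : AdjoinRoot h ≃ₗ[F] (ι → F) // AdjoinRoot.root h * e.symm w₀ = e.symm w₀}

lemma card_fixingEquiv_eq_card_cyclicFixing {h : F[X]} (hh : h.Monic)
    (hd : h.natDegree = Fintype.card ι) (h0 : h.eval 0 ≠ 0) (w₀ : ι → F) :
    Nat.card (FixingEquiv w₀ h) = Nat.card (CyclicFixing w₀ h) * Nat.card (AdjoinRoot h)ˣ := by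
  have hε (x : CyclicFixing w₀ h) : ∃ e : AdjoinRoot h ≃ₗ[F] (ι → F),
      ∀ v, e (AdjoinRoot.root h * v) = x.1.val *ᵥ e v := by
    obtain ⟨x, hx, hx', rfl⟩ := x
    exact exists_linearEquiv_root_mul hx'
  choose ε hε using hε
  let T (p : CyclicFixing w₀ h × (AdjoinRoot h)ˣ) : AdjoinRoot h ≃ₗ[F] (ι → F) :=
    (DistribMulAction.toLinearEquiv F (AdjoinRoot h) p.2).trans (ε p.1)
  have hT_apply (p) (v : AdjoinRoot h) : T p v = ε p.1 (p.2 * v) := rfl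
  have hT (p) (v : AdjoinRoot h) : T p (AdjoinRoot.root h * v) = p.1.1.val *ᵥ T p v := by
    rw [hT_apply, hT_apply, mul_left_comm, hε]
  let T' (p : CyclicFixing w₀ h × (AdjoinRoot h)ˣ) : FixingEquiv w₀ h := ⟨T p, by
    apply (T p).injective
    rw [hT, (T p).apply_symm_apply, p.1.2.1]⟩
  rw [← Nat.card_prod]
  refine (Nat.card_eq_of_bijective T' ⟨?_, ?_⟩).symm
  · rintro ⟨x, u⟩ ⟨y, v⟩ hxy
    have hxy' : T (x, u) = T (y, v) := congrArg Subtype.val hxy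
    have h1 : x = y := by
      refine Subtype.ext ((glLinearEquiv F ι).injective (LinearEquiv.ext fun w => ?_))
      obtain ⟨a, rfl⟩ := (T (x, u)).surjective w
      rw [glLinearEquiv_apply, glLinearEquiv_apply, ← hT (x, u), hxy', ← hT (y, v)]
    subst h1
    have h2 : T (x, u) 1 = T (x, v) 1 := by rw [hxy']
    rw [hT_apply, hT_apply, mul_one, mul_one] at h2
    exact Prod.ext rfl (Units.ext ((ε x).injective h2))
  · rintro ⟨e, he⟩
    have hr : IsUnit (AdjoinRoot.root h) := by
      rw [← AdjoinRoot.mk_X, isUnit_mk_iff, ← sub_zero X, ← C_0,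
        (irreducible_X_sub_C (0 : F)).coprime_iff_not_dvd, dvd_iff_isRoot]
      exact h0
    let x : GL ι F := (glLinearEquiv F ι).symm
      ((e.symm.trans (DistribMulAction.toLinearEquiv F (AdjoinRoot h) hr.unit)).trans e)
    have hx (v) : e (AdjoinRoot.root h * v) = x.val *ᵥ e v := by
      rw [← glLinearEquiv_apply, MulEquiv.apply_symm_apply, LinearEquiv.trans_apply,
        LinearEquiv.trans_apply, e.symm_apply_apply]
      rfl
    obtain ⟨hc, hm⟩ := charpoly_eq_minpoly_of_root_mul hh hd hx
    let y : CyclicFixing w₀ h := ⟨x, by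
      rw [← e.apply_symm_apply w₀, ← hx, he], hc.trans hm.symm, hc⟩
    obtain ⟨u, hu⟩ := exists_unit_of_root_mul hx (hε y)
    exact ⟨(y, u), Subtype.ext (LinearEquiv.ext fun v => (hu v).symm)⟩

lemma card_fixingEquiv_eq_card_fixing {h : F[X]} (hh : h.Monic)
    (hd : h.natDegree = Fintype.card ι) {w₀ : ι → F} (hw₀ : w₀ ≠ 0) :
    Nat.card (FixingEquiv w₀ h) =
      Nat.card {w : AdjoinRoot h // w ≠ 0 ∧ AdjoinRoot.root h * w = w} *
        Nat.card {x : GL ι F // x.val *ᵥ w₀ = w₀} := by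
  have hf := (AdjoinRoot.powerBasis' hh).finite
  obtain ⟨e₁⟩ : Nonempty (AdjoinRoot h ≃ₗ[F] (ι → F)) := by
    refine FiniteDimensional.nonempty_linearEquiv_of_finrank_eq ?_
    rw [(AdjoinRoot.powerBasis' hh).finrank, AdjoinRoot.powerBasis'_dim, hd,
      Module.finrank_fintype_fun_eq_card]
  have hε (w : {w : AdjoinRoot h // w ≠ 0 ∧ AdjoinRoot.root h * w = w}) :
      ∃ e : AdjoinRoot h ≃ₗ[F] (ι → F), e w.1 = w₀ := by
    obtain ⟨g, hg⟩ := exists_linearEquiv_apply_eq (F := F) ((e₁.map_ne_zero_iff).2 w.2.1) hw₀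
    exact ⟨e₁.trans g, hg⟩
  choose ε hε using hε
  let T (p : {w : AdjoinRoot h // w ≠ 0 ∧ AdjoinRoot.root h * w = w} ×
      {x : GL ι F // x.val *ᵥ w₀ = w₀}) : AdjoinRoot h ≃ₗ[F] (ι → F) :=
    (ε p.1).trans (glLinearEquiv F ι p.2.1)
  have hT (p) : (T p).symm w₀ = p.1.1 := by
    rw [LinearEquiv.symm_apply_eq, LinearEquiv.trans_apply, hε, glLinearEquiv_apply, p.2.2]
  rw [← Nat.card_prod]
  refine (Nat.card_eq_of_bijective
    (fun p => (⟨T p, by rw [hT]; exact p.1.2.2⟩ : FixingEquiv w₀ h)) ⟨?_, ?_⟩).symm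
  · rintro ⟨w, x⟩ ⟨w', y⟩ hxy
    have hxy' : T (w, x) = T (w', y) := congrArg Subtype.val hxy
    have h1 : w = w' := Subtype.ext (by rw [← hT (w, x), hxy', hT (w', y)])
    subst h1
    have h2 : x = y := by
      refine Subtype.ext ((glLinearEquiv F ι).injective (LinearEquiv.ext fun v => ?_))
      obtain ⟨a, rfl⟩ := (ε w).surjective v
      exact LinearEquiv.congr_fun hxy' a
    rw [h2]
  · rintro ⟨e, he⟩
    have hne : e.symm w₀ ≠ 0 := (e.symm.map_ne_zero_iff).2 hw₀
    let g : GL ι F := (glLinearEquiv F ι).symm ((ε ⟨_, hne, he⟩).symm.trans e)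
    have hg (v) : g.val *ᵥ v = e ((ε ⟨_, hne, he⟩).symm v) := by
      rw [← glLinearEquiv_apply, MulEquiv.apply_symm_apply, LinearEquiv.trans_apply]
    refine ⟨(⟨_, hne, he⟩, ⟨g, ?_⟩), Subtype.ext (LinearEquiv.ext fun v => ?_)⟩
    · rw [hg, (LinearEquiv.symm_apply_eq _).2 (hε ⟨_, hne, he⟩).symm, e.apply_symm_apply]
    · change g.val *ᵥ _ = _
      rw [hg]
      exact congrArg e (LinearEquiv.symm_apply_apply _ _)

lemma card_root_mul_eq_self [Finite F] {h : F[X]} (hh : h ≠ 0) (h1 : h.eval 1 = 0) :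
    Nat.card {w : AdjoinRoot h // w ≠ 0 ∧ AdjoinRoot.root h * w = w} = Nat.card F - 1 := by
  obtain ⟨k, rfl⟩ := dvd_iff_isRoot.2 (show h.IsRoot 1 from h1)
  have hk : k ≠ 0 := right_ne_zero_of_mul hh
  rw [← Nat.card_units]
  have hT (c : Fˣ) : AdjoinRoot.mk ((X - C 1) * k) (C (c : F) * k) ≠ 0 ∧
      AdjoinRoot.root ((X - C 1) * k) * AdjoinRoot.mk ((X - C 1) * k) (C (c : F) * k) =
        AdjoinRoot.mk ((X - C 1) * k) (C (c : F) * k) := by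
    constructor
    · rw [ne_eq, AdjoinRoot.mk_eq_zero, mul_dvd_mul_iff_right hk]
      exact fun hd => not_isUnit_X_sub_C (1 : F)
        (isUnit_of_dvd_unit hd (isUnit_C.2 c.isUnit))
    · rw [← AdjoinRoot.mk_X, ← map_mul, AdjoinRoot.mk_eq_mk]
      exact ⟨C (c : F), by rw [C_1]; ring⟩
  refine (Nat.card_eq_of_bijective (fun c : Fˣ => (⟨_, hT c⟩ :
    {w : AdjoinRoot ((X - C 1) * k) // w ≠ 0 ∧ AdjoinRoot.root _ * w = w})) ⟨?_, ?_⟩).symm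
  · intro c d hcd
    have := congrArg Subtype.val hcd
    rw [AdjoinRoot.mk_eq_mk, ← sub_mul, mul_dvd_mul_iff_right hk, ← C_sub, dvd_iff_isRoot,
      IsRoot, eval_C, sub_eq_zero] at this
    exact Units.ext this
  · rintro ⟨w, hw, hw'⟩
    obtain ⟨p, rfl⟩ := AdjoinRoot.mk_surjective w
    rw [← AdjoinRoot.mk_X, ← map_mul, AdjoinRoot.mk_eq_mk] at hw'
    obtain ⟨r, rfl⟩ : k ∣ p := by
      refine (mul_dvd_mul_iff_left (X_sub_C_ne_zero (1 : F))).1 (hw'.trans (dvd_of_eq ?_))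
      rw [C_1]; ring
    have hr : AdjoinRoot.mk ((X - C 1) * k) (C (r.eval 1) * k) =
        AdjoinRoot.mk ((X - C 1) * k) (k * r) := by
      rw [mul_comm k r, eq_comm, AdjoinRoot.mk_eq_mk, ← sub_mul, mul_dvd_mul_iff_right hk]
      exact X_sub_C_dvd_sub_C_eval
    have hc : r.eval 1 ≠ 0 := by
      rintro hc
      rw [hc, C_0, zero_mul, map_zero] at hr
      exact hw hr.symm
    exact ⟨Units.mk0 _ hc, Subtype.ext hr⟩

lemma eval_charpoly_of_mulVec_eq {x : Matrix ι ι F} {w₀ : ι → F} (hw₀ : w₀ ≠ 0)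
    (hx : x *ᵥ w₀ = w₀) : x.charpoly.eval 1 = 0 := by
  rw [Matrix.eval_charpoly, ← Matrix.exists_mulVec_eq_zero_iff]
  refine ⟨w₀, hw₀, ?_⟩
  rw [map_one, Matrix.sub_mulVec, Matrix.one_mulVec, hx, sub_self]

lemma eval_charpoly_zero_ne_zero (x : GL ι F) : x.val.charpoly.eval 0 ≠ 0 := by
  intro h
  have := x.isUnit.map Matrix.detMonoidHom
  rw [Matrix.coe_detMonoidHom, Matrix.det_eq_sign_charpoly_coeff, coeff_zero_eq_eval_zero, h,
    mul_zero] at this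
  exact not_isUnit_zero this

open scoped Classical in
lemma card_cyclic_fixing [Finite F] {w₀ : ι → F} (hw₀ : w₀ ≠ 0) :
    (Nat.card {x : GL ι F // x.val *ᵥ w₀ = w₀ ∧ x.val.charpoly = minpoly F x.val} : ℝ) =
      (((Nat.card F : ℝ) - 1) *
        ∑ f ∈ monicFinset F (Fintype.card ι) with f.eval 0 ≠ 0 ∧ f.eval 1 = 0,
          1 / (Nat.card (AdjoinRoot f)ˣ : ℝ)) * Nat.card {x : GL ι F // x.val *ᵥ w₀ = w₀} := by
  have key (f : F[X])
      (hf : f ∈ {f ∈ monicFinset F (Fintype.card ι) | f.eval 0 ≠ 0 ∧ f.eval 1 = 0}) :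
      (Nat.card (CyclicFixing w₀ f) : ℝ) = ((Nat.card F : ℝ) - 1) *
        (1 / (Nat.card (AdjoinRoot f)ˣ : ℝ)) * Nat.card {x : GL ι F // x.val *ᵥ w₀ = w₀} := by
    simp only [Finset.mem_filter, mem_monicFinset] at hf
    obtain ⟨⟨hm, hd⟩, h0, h1⟩ := hf
    have := (AdjoinRoot.powerBasis' hm).finite
    have := Module.finite_of_finite F (M := AdjoinRoot f)
    have e := card_fixingEquiv_eq_card_cyclicFixing hm hd h0 w₀
    rw [card_fixingEquiv_eq_card_fixing hm hd hw₀, card_root_mul_eq_self hm.ne_zero h1] at e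
    have e' := congrArg (Nat.cast (R := ℝ)) e
    have hpos : (Nat.card (AdjoinRoot f)ˣ : ℝ) ≠ 0 := Nat.cast_ne_zero.2 Nat.card_pos.ne'
    rw [Nat.cast_mul, Nat.cast_mul, Nat.cast_sub Finite.card_pos, Nat.cast_one] at e'
    field_simp
    linarith
  rw [Finset.mul_sum, Finset.sum_mul, ← Finset.sum_congr rfl key, ← Nat.cast_sum]
  congr 1
  have := Fintype.ofFinite (GL ι F)
  simp only [Nat.card_eq_fintype_card, Fintype.card_subtype]
  rw [Finset.card_eq_sum_card_fiberwise (f := fun x => x.val.charpoly) (t :=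
    {f ∈ monicFinset F (Fintype.card ι) | f.eval 0 ≠ 0 ∧ f.eval 1 = 0})]
  · simp only [Finset.filter_filter, and_assoc]
  · intro x hx
    simp only [Finset.coe_filter, Finset.mem_univ, true_and, Set.mem_ofPred_eq] at hx
    simp only [Finset.coe_filter, Set.mem_ofPred_eq, mem_monicFinset]
    exact ⟨⟨Matrix.charpoly_monic _, Matrix.charpoly_natDegree_eq_dim _⟩,
      eval_charpoly_zero_ne_zero x, eval_charpoly_of_mulVec_eq hw₀ hx.1⟩

end CyclicMatrix

section AffineGroup

variable {F : Type} [Field F]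

lemma isAff_iff {n : ℕ} (x : GL (Fin (n + 1)) F) :
    IsAff x ↔ x.val *ᵥ Pi.single 0 1 = Pi.single 0 1 := by
  rw [Matrix.mulVec_single_one, funext_iff, Fin.forall_fin_succ]
  simp [IsAff, Fin.forall_fin_succ]

open scoped Classical in
lemma cA_eq_sum [Fintype F] (n : ℕ) :
    cA F n = ((Nat.card F : ℝ) - 1) * ∑ f ∈ monicFinset F (n + 1) with f.eval 0 ≠ 0 ∧ f.eval 1 = 0,
      1 / (Nat.card (AdjoinRoot f)ˣ : ℝ) := by
  have hne : (Pi.single 0 1 : Fin (n + 1) → F) ≠ 0 := by simp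
  have hpos :
      (Nat.card {x : GL (Fin (n + 1)) F // x.val *ᵥ Pi.single 0 1 = Pi.single 0 1} : ℝ) ≠ 0 := by
    have : Nonempty {x : GL (Fin (n + 1)) F // x.val *ᵥ Pi.single 0 1 = Pi.single 0 1} :=
      ⟨1, by rw [Units.val_one, Matrix.one_mulVec]⟩
    exact Nat.cast_ne_zero.2 Nat.card_pos.ne'
  simp only [cA, isAff_iff]
  rw [div_eq_iff hpos, card_cyclic_fixing hne, Fintype.card_fin]

end AffineGroup

/-- As `n → ∞`, the proportion of cyclic elements of `A(n,q)` converges to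
`[(1 - 1/q)/(1 - 1/q + 1/q²)] ⬝ [(1 - 1/q⁵)/(1 + 1/q³)]`. -/
theorem affine_cyclic_limit (F : Type) [Field F] [Fintype F] (q : ℕ)
    (hq : q = Fintype.card F) :
    Filter.Tendsto (fun n : ℕ => cA F n) Filter.atTop
      (nhds (((1 - 1 / (q : ℝ)) / (1 - 1 / (q : ℝ) + 1 / (q : ℝ) ^ 2)) *
        ((1 - 1 / (q : ℝ) ^ 5) / (1 + 1 / (q : ℝ) ^ 3)))) := by
  rw [hq, ← Nat.card_eq_fintype_card]
  simp only [cA_eq_sum]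
  exact tendsto_sum_one_div_card_units.comp (Filter.tendsto_add_atTop_nat 1)
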